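/- For every integer k ≥ 1 there exists a class 𝒞 of finite digraphs, closed under isomorphism, that is decided by a non-adaptive left k-query algorithm over ℕ but is not decided by any adaptive left (k−1)-query algorithm over ℕ. -/

import Mathlib

/-- A finite digraph: a number of vertices together with an edge relation on `Fin n`. -/
abbrev FinDigraph := Σ n : ℕ, (Fin n → Fin n → Prop)

/-- `f` is a homomorphism of digraphs from `A` to `B`. -/
def IsHom (A B : FinDigraph) (f : Fin A.1 → Fin B.1) : Prop :=
  ∀ a b : Fin A.1, A.2 a b → B.2 (f a) (f b)

/-- The number of homomorphisms from `A` to `B`. -/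
noncomputable def homN (A B : FinDigraph) : ℕ :=
  Nat.card {f : Fin A.1 → Fin B.1 // IsHom A B f}
/-- Isomorphism of digraphs. -/
def Iso (A B : FinDigraph) : Prop :=
  ∃ e : Fin A.1 ≃ Fin B.1, ∀ a b : Fin A.1, A.2 a b ↔ B.2 (e a) (e b)
/-- The run of an adaptive left query algorithm over ℕ given by query function
`G` (mapping the list of previous answers to the next queried digraph) on input `A`:
`advRunN G A k` is the list of the first `k` answers. -/
noncomputable def advRunN (G : List ℕ → FinDigraph) (A : FinDigraph) : ℕ → List ℕ
  | 0 => []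
  | j + 1 => advRunN G A j ++ [homN (G (advRunN G A j)) A]

def solS (F : FinDigraph) {Γ : Type} [AddCommGroup Γ] (g : Γ) : Set (Fin F.1 → Γ) :=
  {f | ∀ a b, F.2 a b → f b = f a + g}

def solH (F : FinDigraph) (Γ : Type) [AddCommGroup Γ] : AddSubgroup Γ where
  carrier := {g | (solS F g).Nonempty}
  zero_mem' := ⟨0, fun a b _ => by simp⟩
  add_mem' := by
    rintro g h ⟨f, hf⟩ ⟨f', hf'⟩
    refine ⟨f + f', fun a b hab => ?_⟩
    simp only [Pi.add_apply, hf a b hab, hf' a b hab]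
    abel
  neg_mem' := by
    rintro g ⟨f, hf⟩
    refine ⟨-f, fun a b hab => ?_⟩
    simp only [Pi.neg_apply, hf a b hab]
    abel

noncomputable def cay (Γ : Type) [AddCommGroup Γ] [Fintype Γ] (g : Γ) : FinDigraph :=
  ⟨Fintype.card Γ, fun a b => (Fintype.equivFin Γ).symm b = (Fintype.equivFin Γ).symm a + g⟩

theorem homN_cay (F : FinDigraph) (Γ : Type) [AddCommGroup Γ] [Fintype Γ] (g : Γ) :
    homN F (cay Γ g) = Nat.card (solS F g) := by
  refine Nat.card_congr ?_
  refine Equiv.subtypeEquiv (Equiv.arrowCongr (Equiv.refl _) (Fintype.equivFin Γ).symm) ?_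
  intro f
  rfl

theorem homN_cay_of_mem (F : FinDigraph) (Γ : Type) [AddCommGroup Γ] [Fintype Γ] (g : Γ)
    (h : g ∈ solH F Γ) : homN F (cay Γ g) = Nat.card (solS F (0 : Γ)) := by
  rw [homN_cay]
  obtain ⟨f0, h0⟩ := h
  refine Nat.card_congr ?_
  refine Equiv.subtypeEquiv (Equiv.subRight f0) ?_
  intro f
  constructor
  · intro hf a b hab
    have h1 := hf a b hab
    have h2 := h0 a b hab
    simp only [Equiv.subRight_apply, Pi.sub_apply, h1, h2]
    abel
  · intro hf a b hab
    have h1 := hf a b hab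
    have h2 := h0 a b hab
    simp only [Equiv.subRight_apply, Pi.sub_apply, h2, add_zero] at h1
    rw [sub_eq_iff_eq_add] at h1
    rw [h1]
    abel

theorem homN_cay_of_notMem (F : FinDigraph) (Γ : Type) [AddCommGroup Γ] [Fintype Γ] (g : Γ)
    (h : g ∉ solH F Γ) : homN F (cay Γ g) = 0 := by
  rw [homN_cay]
  have : solS F g = ∅ := Set.not_nonempty_iff_eq_empty.mp h
  rw [this]
  simp

theorem homN_cay_eq_zero (F : FinDigraph) (Γ : Type) [AddCommGroup Γ] [Fintype Γ] (g : Γ) :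
    homN F (cay Γ g) = 0 ↔ g ∉ solH F Γ := by
  refine ⟨fun h hm => ?_, homN_cay_of_notMem F Γ g⟩
  rw [homN_cay] at h
  obtain ⟨f0, h0⟩ := hm
  haveI : Nonempty (solS F g) := ⟨⟨f0, h0⟩⟩
  exact Nat.card_pos.ne' h

def dicyc (n : ℕ) : FinDigraph := ⟨n, fun a b => (b : ℕ) = (a + 1) % n⟩

theorem mem_solH_dicyc (n : ℕ) (hn : 0 < n) (Γ : Type) [AddCommGroup Γ] (g : Γ) :
    g ∈ solH (dicyc n) Γ ↔ n • g = 0 := by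
  constructor
  · rintro ⟨f, hf⟩
    have key : ∀ j (hj : j < n), f ⟨j, hj⟩ = f ⟨0, hn⟩ + j • g := by
      intro j
      induction j with
      | zero => intro _; simp
      | succ j ih =>
        intro hj
        have h1 := hf ⟨j, (by omega : j < n)⟩ ⟨j + 1, hj⟩ (Nat.mod_eq_of_lt hj).symm
        rw [h1, ih (by omega), succ_nsmul]
        abel
    have h1 := hf ⟨n - 1, (by omega : n - 1 < n)⟩ ⟨0, hn⟩ (by
      change 0 = (n - 1 + 1) % n
      rw [Nat.sub_add_cancel hn, Nat.mod_self])
    rw [key (n - 1) (by omega), add_assoc, ← succ_nsmul, Nat.sub_add_cancel hn] at h1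
    exact left_eq_add.mp h1
  · intro h
    refine ⟨fun a => (a : ℕ) • g, fun a b hab => ?_⟩
    have hab' : (b : ℕ) = (a + 1) % n := hab
    have ha : (a : ℕ) < n := a.2
    change (b : ℕ) • g = (a : ℕ) • g + g
    rw [hab', ← succ_nsmul]
    conv_rhs => rw [← Nat.mod_add_div ((a : ℕ) + 1) n, add_nsmul, mul_comm, mul_nsmul', h, nsmul_zero, add_zero]

noncomputable def pr (i : ℕ) : ℕ := Nat.nth Nat.Prime i

instance prFact (i : ℕ) : Fact (pr i).Prime := ⟨Nat.prime_nth_prime i⟩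

theorem pr_inj : Function.Injective pr := Nat.nth_injective Nat.infinite_setOfPred_prime

abbrev GG (k : ℕ) : Type := (i : Fin k) → ZMod (pr i)

noncomputable def gx {k : ℕ} (x : Finset (Fin k)) : GG k := fun i => if i ∈ x then 1 else 0

noncomputable def nn {k : ℕ} (i : Fin k) : ℕ := ∏ j ∈ Finset.univ.erase i, pr j

theorem nn_coprime {k : ℕ} (i : Fin k) : (nn i).Coprime (pr i) := by
  refine Nat.Coprime.prod_left fun j hj => ?_
  refine (Nat.coprime_primes (prFact j).out (prFact i).out).mpr fun h => ?_
  exact (Finset.mem_erase.mp hj).1 (Fin.ext (pr_inj h))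

theorem nn_smul {k : ℕ} (i : Fin k) (v : GG k) (j : Fin k) (h : j ≠ i) : (nn i • v) j = 0 := by
  have : pr j ∣ nn i := Finset.dvd_prod_of_mem _ (Finset.mem_erase.mpr ⟨h, Finset.mem_univ j⟩)
  rw [Pi.smul_apply, nsmul_eq_mul, (ZMod.natCast_eq_zero_iff _ _).mpr this, zero_mul]

theorem nn_ne {k : ℕ} (i : Fin k) : ((nn i : ℕ) : ZMod (pr i)) ≠ 0 := by
  intro h
  rw [ZMod.natCast_eq_zero_iff] at h
  have := Nat.Coprime.eq_one_of_dvd (nn_coprime i).symm h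
  exact (prFact i).out.one_lt.ne' this

theorem nn_pos {k : ℕ} (i : Fin k) : 0 < nn i :=
  Finset.prod_pos fun j _ => (prFact j).out.pos

theorem nn_gx {k : ℕ} (i : Fin k) (x : Finset (Fin k)) : nn i • gx x = 0 ↔ i ∉ x := by
  constructor
  · intro h hi
    have := congrFun h i
    simp only [Pi.smul_apply, gx, hi, if_true, nsmul_eq_mul, mul_one, Pi.zero_apply] at this
    exact nn_ne i this
  · intro hi
    funext j
    by_cases h : j = i
    · subst h
      simp [gx, hi]
    · exact nn_smul i _ j h

theorem single_mem {k : ℕ} (H : AddSubgroup (GG k)) (x : Finset (Fin k)) (hx : gx x ∈ H)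
    (i : Fin k) (hi : i ∈ x) : gx {i} ∈ H := by
  have h1 : nn i • gx {i} ∈ H := by
    have : nn i • gx {i} = nn i • gx x := by
      funext j
      by_cases h : j = i
      · subst h
        simp [gx, hi]
      · rw [nn_smul i _ j h, nn_smul i _ j h]
    rw [this]
    exact H.nsmul_mem hx _
  have h2 : pr i • gx {i} = (0 : GG k) := by
    funext j
    by_cases h : j = i
    · subst h
      simp [gx]
    · simp [gx, h]
  have hb := Nat.gcd_eq_gcd_ab (nn i) (pr i)
  rw [(nn_coprime i)] at hb
  have h3 : gx {i} = (Nat.gcdA (nn i) (pr i)) • (nn i • gx {i})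
      + (Nat.gcdB (nn i) (pr i)) • (pr i • gx {i}) := by
    rw [← natCast_zsmul, ← natCast_zsmul, ← mul_zsmul', ← mul_zsmul', ← add_zsmul,
      ← hb, Nat.cast_one, one_zsmul]
  rw [h3, h2, zsmul_zero, add_zero]
  exact H.zsmul_mem h1 _

theorem gx_insert {k : ℕ} (x : Finset (Fin k)) (i : Fin k) (hi : i ∉ x) :
    gx (insert i x) = gx x + gx {i} := by
  funext j
  by_cases h : j = i
  · subst h
    simp [gx, hi]
  · simp [gx, h]

theorem gx_mem_iff {k : ℕ} (H : AddSubgroup (GG k)) (S : Finset (Fin k))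
    (hS : ∀ i, i ∉ S → gx {i} ∈ H) (D : Finset (Fin k)) :
    (gx (D ∪ S) ∈ H ↔ gx S ∈ H) := by
  induction D using Finset.induction_on with
  | empty => simp
  | insert i D hi ih =>
    rw [Finset.insert_union]
    by_cases h : i ∈ D ∪ S
    · rw [Finset.insert_eq_of_mem h, ih]
    · rw [gx_insert _ _ h, ← ih]
      refine H.add_mem_cancel_right (hS i fun h' => h (Finset.mem_union_right _ h'))

theorem adversary (k : ℕ) (G : List ℕ → FinDigraph) (j : ℕ) :
    ∃ S : Finset (Fin k), S.card ≤ j ∧ ∃ L, ∀ x, S ⊆ x →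
      advRunN G (cay (GG k) (gx x)) j = L := by
  induction j with
  | zero => exact ⟨∅, by simp, [], fun _ _ => rfl⟩
  | succ j ih =>
    obtain ⟨S, hS, L, hL⟩ := ih
    by_cases h : ∃ i, i ∉ S ∧ gx {i} ∉ solH (G L) (GG k)
    · obtain ⟨i, hi, hn⟩ := h
      refine ⟨insert i S, (Finset.card_insert_le _ _).trans (by omega), L ++ [0], ?_⟩
      intro x hx
      have h1 := hL x ((Finset.subset_insert _ _).trans hx)
      rw [advRunN, h1, homN_cay_of_notMem]
      exact fun hm => hn (single_mem _ x hm i (hx (Finset.mem_insert_self _ _)))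
    · push Not at h
      refine ⟨S, by omega, L ++ [homN (G L) (cay (GG k) (gx S))], ?_⟩
      intro x hx
      rw [advRunN, hL x hx]
      have h2 := gx_mem_iff _ S h x
      rw [Finset.union_eq_left.mpr hx] at h2
      by_cases hm : gx S ∈ solH (G L) (GG k)
      · rw [homN_cay_of_mem _ _ _ hm, homN_cay_of_mem _ _ _ (h2.mpr hm)]
      · rw [homN_cay_of_notMem _ _ _ hm, homN_cay_of_notMem _ _ _ (fun h' => hm (h2.mp h'))]

theorem homN_iso (F A B : FinDigraph) (h : Iso A B) : homN F A = homN F B := by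
  obtain ⟨e, he⟩ := h
  refine Nat.card_congr ?_
  refine Equiv.subtypeEquiv (Equiv.arrowCongr (Equiv.refl _) e) ?_
  intro f
  constructor
  · intro hf a b hab
    exact (he _ _).mp (hf a b hab)
  · intro hf a b hab
    exact (he _ _).mpr (hf a b hab)

/-- for every `k ≥ 1` there is an isomorphism-closed class of finite
digraphs decided by a non-adaptive left `k`-query algorithm over ℕ but not by any
adaptive left `(k-1)`-query algorithm over ℕ. -/
theorem stmt6 (k : ℕ) (hk : 1 ≤ k) :
    ∃ C : Set FinDigraph,
      (∀ A B : FinDigraph, Iso A B → (A ∈ C ↔ B ∈ C)) ∧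
      (∃ (F : Fin k → FinDigraph) (X : Set (Fin k → ℕ)),
        ∀ A : FinDigraph, A ∈ C ↔ (fun i => homN (F i) A) ∈ X) ∧
      (∀ (G : List ℕ → FinDigraph) (X : Set (List ℕ)),
        ¬ ∀ A : FinDigraph, (A ∈ C ↔ advRunN G A (k - 1) ∈ X)) := by
  classical
  let X : Set (Fin k → ℕ) := {v | Even (Finset.univ.filter fun i => v i = 0).card}
  let F : Fin k → FinDigraph := fun i => dicyc (nn i)
  refine ⟨{A | (fun i => homN (F i) A) ∈ X}, ?_, ⟨F, X, fun A => Iff.rfl⟩, ?_⟩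
  · intro A B h
    have : (fun i => homN (F i) A) = fun i => homN (F i) B := by
      funext i
      exact homN_iso _ _ _ h
    simp only [Set.mem_ofPred_eq, this]
  · intro G Y hY
    have hC : ∀ x : Finset (Fin k),
        (Even x.card ↔ advRunN G (cay (GG k) (gx x)) (k - 1) ∈ Y) := by
      intro x
      rw [← hY]
      have : (Finset.univ.filter fun i => homN (F i) (cay (GG k) (gx x)) = 0) = x := by
        ext i
        rw [Finset.mem_filter, homN_cay_eq_zero, mem_solH_dicyc _ (nn_pos i), nn_gx]
        simp
      change _ ↔ Even (Finset.univ.filter fun i => homN (F i) (cay (GG k) (gx x)) = 0).card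
      rw [this]
    obtain ⟨S, hS, L, hL⟩ := adversary k G (k - 1)
    obtain ⟨i, hi⟩ : ∃ i, i ∉ S := by
      by_contra! h
      have : S = Finset.univ := Finset.eq_univ_of_forall h
      rw [this, Finset.card_univ, Fintype.card_fin] at hS
      omega
    have h1 := hC S
    have h2 := hC (insert i S)
    rw [hL _ (Finset.Subset.refl _)] at h1
    rw [hL _ (Finset.subset_insert _ _), Finset.card_insert_of_notMem hi, ← h1] at h2
    rw [Nat.even_add_one] at h2
    tauto
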